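/- The F-curve degrees of the symmetric divisor D₀ on Mbar_{0,12} are given by the following formula: for every partition of X = Option (ZMod 11) into four nonempty subsets A₁, A₂, A₃, A₄, the quantity w₀(A₁∪A₂) + w₀(A₁∪A₃) + w₀(A₁∪A₄) − w₀(A₁) − w₀(A₂) − w₀(A₃) − w₀(A₄) equals 0 if max_i |A_i| ≥ 6, and equals min(min_i |A_i|, 6 − max_i |A_i|) otherwise. -/

import Mathlib

open Finset

/-- The 12-element index type of marked points of `Mbar_{0,12}`;
`none` is the 12th marked point. -/
abbrev X : Type := Option (ZMod 11)

/-- The Kapranov coefficient function of the symmetric divisor `D₀`. -/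
def d0 : Finset (ZMod 11) → ℤ := fun S =>
  if S.card = 0 then -5
  else if S.card = 1 then -4
  else if S.card = 2 then -3
  else if S.card = 3 then -2
  else if S.card = 4 then -1
  else 0

/-- Extension of a Kapranov coefficient function on `Finset (ZMod 11)` to all boundary
classes, indexed by subsets `T ⊆ X`. -/
def extendCoeff (e : Finset (ZMod 11) → ℤ) : Finset X → ℤ := fun T =>
  if none ∈ T then e (Finset.univ.filter fun a : ZMod 11 => some a ∈ T)
  else e (Finset.univ.filter fun a : ZMod 11 => some a ∉ T)

theorem d0_eq_min (S : Finset (ZMod 11)) : d0 S = min 0 ((S.card : ℤ) - 5) := by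
  unfold d0
  split_ifs <;> omega

theorem card_filter_some_mem {α : Type*} [Fintype α] [DecidableEq α] (T : Finset (Option α)) :
    (univ.filter fun a : α => some a ∈ T).card = (T.erase none).card := by
  rw [← card_map Function.Embedding.some]
  congr 1
  ext (_ | a) <;> simp

theorem extendCoeff_d0 (T : Finset X) :
    extendCoeff d0 T = min 0 (6 - (T.card : ℤ)) + if none ∈ T then (T.card : ℤ) - 6 else 0 := by
  unfold extendCoeff
  split_ifs with h
  · have hc := card_erase_add_one h
    rw [d0_eq_min, card_filter_some_mem]
    omega
  · have hs := card_filter_some_mem T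
    have hn := card_filter_add_card_filter_not (s := (univ : Finset (ZMod 11)))
      (fun a => some a ∈ T)
    rw [erase_eq_of_notMem h] at hs
    rw [card_univ, ZMod.card] at hn
    rw [d0_eq_min]
    omega

theorem min_sum_eq_of_add_eq_twelve {a b c d : ℕ} (ha : 0 < a) (hb : 0 < b) (hc : 0 < c)
    (hd : 0 < d) (h : a + b + c + d = 12) :
    min 0 (6 - ((a : ℤ) + b)) + min 0 (6 - ((a : ℤ) + c)) + min 0 (6 - ((a : ℤ) + d)) -
        min 0 (6 - (a : ℤ)) - min 0 (6 - (b : ℤ)) - min 0 (6 - (c : ℤ)) - min 0 (6 - (d : ℤ)) + a =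
      if 6 ≤ max (max a b) (max c d) then 0
      else min (min (min a b) (min c d) : ℤ) (6 - (max (max a b) (max c d) : ℤ)) := by
  have ha' : a ≤ 9 := by omega
  have hb' : b ≤ 9 := by omega
  have hc' : c ≤ 9 := by omega
  obtain rfl : d = 12 - a - b - c := by omega
  interval_cases a <;> interval_cases b <;> interval_cases c <;> omega

/-- The F-curve degrees of the symmetric divisor `D₀` on `Mbar_{0,12}`: the degree on
`C_{A₁A₂A₃A₄}` is `0` if some part has at least 6 elements, and is
`min(minᵢ |Aᵢ|, 6 − maxᵢ |Aᵢ|)` otherwise. -/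
theorem D0_F_degree (A₁ A₂ A₃ A₄ : Finset X)
    (h₁ : A₁.Nonempty) (h₂ : A₂.Nonempty) (h₃ : A₃.Nonempty) (h₄ : A₄.Nonempty)
    (h₁₂ : Disjoint A₁ A₂) (h₁₃ : Disjoint A₁ A₃) (h₁₄ : Disjoint A₁ A₄)
    (h₂₃ : Disjoint A₂ A₃) (h₂₄ : Disjoint A₂ A₄) (h₃₄ : Disjoint A₃ A₄)
    (hU : A₁ ∪ A₂ ∪ A₃ ∪ A₄ = Finset.univ) :
    extendCoeff d0 (A₁ ∪ A₂) + extendCoeff d0 (A₁ ∪ A₃) + extendCoeff d0 (A₁ ∪ A₄)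
        - extendCoeff d0 A₁ - extendCoeff d0 A₂ - extendCoeff d0 A₃
        - extendCoeff d0 A₄ =
      if 6 ≤ max (max A₁.card A₂.card) (max A₃.card A₄.card) then 0
      else min (min (min A₁.card A₂.card) (min A₃.card A₄.card) : ℤ)
        (6 - (max (max A₁.card A₂.card) (max A₃.card A₄.card) : ℤ)) := by
  have hcard : A₁.card + A₂.card + A₃.card + A₄.card = 12 := by
    have h := congrArg card hU
    rw [card_union_of_disjoint (by simp [*]), card_union_of_disjoint (by simp [*]),
      card_union_of_disjoint h₁₂, card_univ, Fintype.card_option, ZMod.card] at h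
    exact h
  have hnone : none ∈ A₁ ∪ A₂ ∪ A₃ ∪ A₄ := hU ▸ mem_univ _
  have key := min_sum_eq_of_add_eq_twelve h₁.card_pos h₂.card_pos h₃.card_pos h₄.card_pos hcard
  simp only [extendCoeff_d0, card_union_of_disjoint h₁₂, card_union_of_disjoint h₁₃,
    card_union_of_disjoint h₁₄, mem_union, Nat.cast_add] at hnone ⊢
  rw [← key]
  rw [disjoint_left] at h₁₂ h₁₃ h₁₄ h₂₃ h₂₄ h₃₄
  have hcard' : (A₁.card + A₂.card + A₃.card + A₄.card : ℤ) = 12 := mod_cast hcard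
  specialize @h₁₂ none
  specialize @h₁₃ none
  specialize @h₁₄ none
  specialize @h₂₃ none
  specialize @h₂₄ none
  specialize @h₃₄ none
  clear key
  rcases hnone with ((h | h) | h) | h <;> simp_all <;> linarith
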